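/- Let G be a group, k a field, kG the group Hopf algebra with basis {δ_g}_{g∈G}, and let C be a symmetric left partial kG-module coalgebra. For g ∈ G define P_g: C → C by P_g(c) = ε(δ_{g⁻¹}·c₍₁₎)c₍₂₎. Then for all g, h ∈ G and c ∈ C: (a) P_g(c) = c₍₁₎ε(δ_{g⁻¹}·c₍₂₎); (b) P_g(c) = δ_g·(δ_{g⁻¹}·c); (c) P_g∘P_g = P_g; (d) Δ∘P_g = (P_g ⊗ P_g)∘Δ; (e) P_g(c) = c₍₁₎ε(P_g(c₍₂₎)) = ε(P_g(c₍₁₎))c₍₂₎; (f) P_g∘P_h = P_h∘P_g; (g) P_e = id_C, where e is the unit of G. -/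

import Mathlib

open TensorProduct

/-- `sw4 k f₁ f₂ h c = ∑ f₁(h₍₁₎ ⊗ c₍₁₎) ⊗ f₂(h₍₂₎ ⊗ c₍₂₎)` in Sweedler notation. -/
noncomputable def sw4 (k : Type*) [Field k] {H C M N : Type*}
    [AddCommGroup H] [Module k H] [Coalgebra k H]
    [AddCommGroup C] [Module k C] [Coalgebra k C]
    [AddCommGroup M] [Module k M] [AddCommGroup N] [Module k N]
    (f₁ : H ⊗[k] C →ₗ[k] M) (f₂ : H ⊗[k] C →ₗ[k] N) (h : H) (c : C) : M ⊗[k] N :=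
  (TensorProduct.map f₁ f₂)
    ((TensorProduct.tensorTensorTensorComm k H H C C)
      ((Coalgebra.comul (R := k) h) ⊗ₜ[k] (Coalgebra.comul (R := k) c)))
/-- A left partial `H`-module coalgebra: (PLHMC1) `Δ(h·c) = ∑ (h₍₁₎·c₍₁₎) ⊗ (h₍₂₎·c₍₂₎)`;
(PLHMC2) `1·c = c`; (PLHMC3) `h·(g·c) = ∑ (hg₍₁₎·c₍₁₎) ε(g₍₂₎·c₍₂₎)`. -/
structure IsPartialModuleCoalgebra (k : Type*) [Field k] {H C : Type*} [Ring H] [Bialgebra k H]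
    [AddCommGroup C] [Module k C] [Coalgebra k C] (act : H →ₗ[k] C →ₗ[k] C) : Prop where
  plhmc1 : ∀ (h : H) (c : C), Coalgebra.comul (R := k) (act h c) =
    sw4 k (TensorProduct.lift act) (TensorProduct.lift act) h c
  plhmc2 : ∀ c : C, act 1 c = c
  plhmc3 : ∀ (h g : H) (c : C), act h (act g c) =
    (TensorProduct.rid k C) (sw4 k
      (TensorProduct.lift act ∘ₗ TensorProduct.map (LinearMap.mulLeft k h) LinearMap.id)
      (Coalgebra.counit ∘ₗ TensorProduct.lift act) g c)
/-- A symmetric left partial `H`-module coalgebra: a left partial `H`-module coalgebra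
which moreover satisfies (PLHMC3') `h·(g·c) = ∑ ε(g₍₁₎·c₍₁₎) (hg₍₂₎·c₍₂₎)`. -/
structure IsSymmPartialModuleCoalgebra (k : Type*) [Field k] {H C : Type*}
    [Ring H] [Bialgebra k H] [AddCommGroup C] [Module k C] [Coalgebra k C]
    (act : H →ₗ[k] C →ₗ[k] C) extends IsPartialModuleCoalgebra k act : Prop where
  plhmc3' : ∀ (h g : H) (c : C), act h (act g c) =
    (TensorProduct.lid k C) (sw4 k
      (Coalgebra.counit ∘ₗ TensorProduct.lift act)
      (TensorProduct.lift act ∘ₗ TensorProduct.map (LinearMap.mulLeft k h) LinearMap.id) g c)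
/-- The projection `P(c) = ∑ ε(u·c₍₁₎)c₍₂₎` associated to an element `u` of `H` acting on `C`. -/
noncomputable def Pmap (k : Type*) [Field k] {H C : Type*}
    [AddCommGroup H] [Module k H]
    [AddCommGroup C] [Module k C] [Coalgebra k C]
    (act : H →ₗ[k] C →ₗ[k] C) (u : H) : C →ₗ[k] C :=
  (TensorProduct.lid k C).toLinearMap ∘ₗ
    TensorProduct.map (Coalgebra.counit ∘ₗ act u) LinearMap.id ∘ₗ Coalgebra.comul

section Hit

variable {k C : Type*} [Field k] [AddCommGroup C] [Module k C] [Coalgebra k C]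

/-- The map `c ↦ ∑ φ(c₍₁₎)c₍₂₎`. -/
noncomputable def leftHit (φ : C →ₗ[k] k) : C →ₗ[k] C :=
  (TensorProduct.lid k C).toLinearMap ∘ₗ TensorProduct.map φ LinearMap.id ∘ₗ Coalgebra.comul

/-- The map `c ↦ ∑ c₍₁₎φ(c₍₂₎)`. -/
noncomputable def rightHit (φ : C →ₗ[k] k) : C →ₗ[k] C :=
  (TensorProduct.rid k C).toLinearMap ∘ₗ TensorProduct.map LinearMap.id φ ∘ₗ Coalgebra.comul

lemma leftHit_apply (φ : C →ₗ[k] k) (c : C) : leftHit φ c =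
    TensorProduct.lid k C (TensorProduct.map φ LinearMap.id (Coalgebra.comul (R := k) c)) := rfl

lemma rightHit_apply (φ : C →ₗ[k] k) (c : C) : rightHit φ c =
    TensorProduct.rid k C (TensorProduct.map LinearMap.id φ (Coalgebra.comul (R := k) c)) := rfl

lemma counit_leftHit (φ : C →ₗ[k] k) (c : C) :
    Coalgebra.counit (R := k) (leftHit φ c) = φ c := by
  have key : ∀ x : C ⊗[k] C, Coalgebra.counit (R := k)
      (TensorProduct.lid k C (TensorProduct.map φ LinearMap.id x)) =
      φ (TensorProduct.rid k C ((Coalgebra.counit (R := k)).lTensor C x)) := by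
    intro x
    induction x with
    | zero => simp
    | add x y hx hy => simp only [map_add, hx, hy]
    | tmul a b => simp [mul_comm]
  rw [leftHit_apply, key, Coalgebra.lTensor_counit_comul]
  simp

lemma leftHit_counit (c : C) : leftHit (Coalgebra.counit (R := k)) c = c := by
  have h := Coalgebra.rTensor_counit_comul (R := k) c
  rw [LinearMap.rTensor] at h
  rw [leftHit_apply, h]
  simp

lemma comul_leftHit (φ : C →ₗ[k] k) (c : C) :
    Coalgebra.comul (R := k) (leftHit φ c) =
      TensorProduct.map (leftHit φ) LinearMap.id (Coalgebra.comul (R := k) c) := by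
  have hl : ∀ x : C ⊗[k] C, Coalgebra.comul (R := k)
      (TensorProduct.lid k C (TensorProduct.map φ LinearMap.id x)) =
      TensorProduct.lid k (C ⊗[k] C)
        (TensorProduct.map φ LinearMap.id (Coalgebra.comul.lTensor C x)) := by
    intro x
    induction x with
    | zero => simp
    | add x y hx hy => simp only [map_add, hx, hy]
    | tmul a b => simp
  have ha : ∀ (b : C) (y : C ⊗[k] C), TensorProduct.lid k (C ⊗[k] C)
      (TensorProduct.map φ LinearMap.id (TensorProduct.assoc k C C C (y ⊗ₜ[k] b))) =
      TensorProduct.lid k C (TensorProduct.map φ LinearMap.id y) ⊗ₜ[k] b := by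
    intro b y
    induction y with
    | zero => simp
    | add x y hx hy => simp only [map_add, TensorProduct.add_tmul, hx, hy]
    | tmul a b => simp [TensorProduct.smul_tmul']
  rw [leftHit_apply, hl, ← Coalgebra.coassoc_apply]
  induction Coalgebra.comul (R := k) c with
  | zero => simp
  | add x y hx hy => simp only [map_add, hx, hy]
  | tmul a b => simp [ha, leftHit_apply]

lemma comul_rightHit (φ : C →ₗ[k] k) (c : C) :
    Coalgebra.comul (R := k) (rightHit φ c) =
      TensorProduct.map LinearMap.id (rightHit φ) (Coalgebra.comul (R := k) c) := by
  have hr : ∀ x : C ⊗[k] C, Coalgebra.comul (R := k)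
      (TensorProduct.rid k C (TensorProduct.map LinearMap.id φ x)) =
      TensorProduct.rid k (C ⊗[k] C)
        (TensorProduct.map LinearMap.id φ (Coalgebra.comul.rTensor C x)) := by
    intro x
    induction x with
    | zero => simp
    | add x y hx hy => simp only [map_add, hx, hy]
    | tmul a b => simp
  have ha : ∀ (a : C) (y : C ⊗[k] C), TensorProduct.rid k (C ⊗[k] C)
      (TensorProduct.map LinearMap.id φ ((TensorProduct.assoc k C C C).symm (a ⊗ₜ[k] y))) =
      a ⊗ₜ[k] TensorProduct.rid k C (TensorProduct.map LinearMap.id φ y) := by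
    intro a y
    induction y with
    | zero => simp
    | add x y hx hy => simp only [map_add, TensorProduct.tmul_add, hx, hy]
    | tmul a b => simp
  rw [rightHit_apply, hr, ← Coalgebra.coassoc_symm_apply]
  induction Coalgebra.comul (R := k) c with
  | zero => simp
  | add x y hx hy => simp only [map_add, hx, hy]
  | tmul a b => simp [ha, rightHit_apply]

lemma leftHit_rightHit_comm (φ ψ : C →ₗ[k] k) (c : C) :
    leftHit φ (rightHit ψ c) = rightHit ψ (leftHit φ c) := by
  rw [leftHit_apply φ (rightHit ψ c), comul_rightHit, leftHit_apply φ c]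
  induction Coalgebra.comul (R := k) c with
  | zero => simp
  | add x y hx hy => simp only [map_add, hx, hy]
  | tmul a b => simp

/-- If `φ` is idempotent for the convolution product, then `leftHit φ` is idempotent. -/
lemma leftHit_leftHit_of_idem {φ : C →ₗ[k] k} (hφ : ∀ c, φ (leftHit φ c) = φ c) (c : C) :
    leftHit φ (leftHit φ c) = leftHit φ c := by
  rw [leftHit_apply φ (leftHit φ c), comul_leftHit, leftHit_apply φ c]
  induction Coalgebra.comul (R := k) c with
  | zero => simp
  | add x y hx hy => simp only [map_add, hx, hy]
  | tmul a b => simp [hφ]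

/-- If `φ` is idempotent for the convolution product and acts in the same way from both sides,
then `leftHit φ` is comultiplicative. -/
lemma comul_leftHit_of_idem {φ : C →ₗ[k] k} (hφ : ∀ c, φ (leftHit φ c) = φ c)
    (hlr : leftHit φ = rightHit φ) (c : C) :
    Coalgebra.comul (R := k) (leftHit φ c) =
      TensorProduct.map (leftHit φ) (leftHit φ) (Coalgebra.comul (R := k) c) := by
  rw [← leftHit_leftHit_of_idem hφ, comul_leftHit]
  nth_rw 2 [hlr]
  rw [comul_rightHit, ← hlr]
  induction Coalgebra.comul (R := k) c with
  | zero => simp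
  | add x y hx hy => simp only [map_add, hx, hy]
  | tmul a b => simp

end Hit

section GroupLike

variable {k H C : Type*} [Field k] [Ring H] [Bialgebra k H] [AddCommGroup C] [Module k C]
  [Coalgebra k C] {act : H →ₗ[k] C →ₗ[k] C}

lemma sw4_groupLike {M N : Type*} [AddCommGroup M] [Module k M] [AddCommGroup N] [Module k N]
    (f₁ : H ⊗[k] C →ₗ[k] M) (f₂ : H ⊗[k] C →ₗ[k] N) {u : H}
    (hu : Coalgebra.comul (R := k) u = u ⊗ₜ[k] u) (c : C) :
    sw4 k f₁ f₂ u c = TensorProduct.map (f₁ ∘ₗ TensorProduct.mk k H C u)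
      (f₂ ∘ₗ TensorProduct.mk k H C u) (Coalgebra.comul (R := k) c) := by
  rw [sw4, hu]
  induction Coalgebra.comul (R := k) c with
  | zero => simp
  | add x y hx hy => simp only [map_add, TensorProduct.tmul_add, hx, hy]
  | tmul a b => simp

lemma Pmap_eq_leftHit (act : H →ₗ[k] C →ₗ[k] C) (u : H) :
    Pmap k act u = leftHit (Coalgebra.counit ∘ₗ act u) := rfl

lemma IsPartialModuleCoalgebra.counit_act_leftHit (hact : IsPartialModuleCoalgebra k act) {u : H}
    (hu : Coalgebra.comul (R := k) u = u ⊗ₜ[k] u) (c : C) :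
    (Coalgebra.counit ∘ₗ act u) (leftHit (Coalgebra.counit ∘ₗ act u) c) =
      (Coalgebra.counit (R := k) ∘ₗ act u) c := by
  have h := leftHit_counit (k := k) (act u c)
  rw [leftHit_apply, hact.plhmc1, sw4_groupLike _ _ hu] at h
  rw [LinearMap.comp_apply _ (act u) c, ← h, leftHit_apply]
  induction Coalgebra.comul (R := k) c with
  | zero => simp
  | add x y hx hy => simp only [map_add, hx, hy]
  | tmul a b => simp

lemma IsPartialModuleCoalgebra.rightHit_eq_act_act (hact : IsPartialModuleCoalgebra k act)
    {v u : H} (hu : Coalgebra.comul (R := k) u = u ⊗ₜ[k] u) (hvu : v * u = 1) (c : C) :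
    rightHit (Coalgebra.counit ∘ₗ act u) c = act v (act u c) := by
  rw [hact.plhmc3, sw4_groupLike _ _ hu, rightHit_apply]
  congr 3
  all_goals
    ext x
    simp [hvu, hact.plhmc2]

lemma IsSymmPartialModuleCoalgebra.leftHit_eq_act_act (hact : IsSymmPartialModuleCoalgebra k act)
    {v u : H} (hu : Coalgebra.comul (R := k) u = u ⊗ₜ[k] u) (hvu : v * u = 1) (c : C) :
    leftHit (Coalgebra.counit ∘ₗ act u) c = act v (act u c) := by
  rw [hact.plhmc3', sw4_groupLike _ _ hu, leftHit_apply]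
  congr 3
  all_goals
    ext x
    simp [hvu, hact.plhmc2]

end GroupLike

/-- Let `H = kG` be the group Hopf algebra of a group `G`, with basis `{δ_g}` of grouplike
elements, and let `C` be a symmetric left partial `kG`-module coalgebra. With
`P_g(c) := ∑ ε(δ_{g⁻¹}·c₍₁₎)c₍₂₎` (given by `Pmap k act (δ g⁻¹)`):
(a) `P_g(c) = ∑ c₍₁₎ε(δ_{g⁻¹}·c₍₂₎)`; (b) `P_g(c) = δ_g·(δ_{g⁻¹}·c)`; (c) `P_g∘P_g = P_g`;
(d) `Δ∘P_g = (P_g ⊗ P_g)∘Δ`; (e) `P_g(c) = ∑ c₍₁₎ε(P_g(c₍₂₎)) = ∑ ε(P_g(c₍₁₎))c₍₂₎`;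
(f) `P_g∘P_h = P_h∘P_g`; (g) `P_e = id_C`. -/
theorem groupAlgebra_partialModuleCoalgebra_projections
    {k G H C : Type*} [Field k] [Group G] [Ring H] [HopfAlgebra k H]
    [AddCommGroup C] [Module k C] [Coalgebra k C]
    -- `H` is the group algebra `kG` with basis `{δ_g}_{g ∈ G}`:
    (δ : G →* H)
    (hbasis : LinearIndependent k (fun g : G => δ g))
    (hspan : Submodule.span k (Set.range (fun g : G => δ g)) = ⊤)
    (hcomul : ∀ g : G, Coalgebra.comul (R := k) (δ g) = δ g ⊗ₜ[k] δ g)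
    (hcounit : ∀ g : G, Coalgebra.counit (R := k) (δ g) = 1)
    (hantipode : ∀ g : G, HopfAlgebra.antipode (R := k) (δ g) = δ g⁻¹)
    -- `C` is a symmetric left partial `kG`-module coalgebra:
    (act : H →ₗ[k] C →ₗ[k] C) (hact : IsSymmPartialModuleCoalgebra k act) :
    -- (a)
    (∀ (g : G) (c : C), Pmap k act (δ g⁻¹) c = (TensorProduct.rid k C)
      (TensorProduct.map LinearMap.id (Coalgebra.counit ∘ₗ act (δ g⁻¹))
        (Coalgebra.comul (R := k) c))) ∧
    -- (b)
    (∀ (g : G) (c : C), Pmap k act (δ g⁻¹) c = act (δ g) (act (δ g⁻¹) c)) ∧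
    -- (c)
    (∀ (g : G) (c : C), Pmap k act (δ g⁻¹) (Pmap k act (δ g⁻¹) c) = Pmap k act (δ g⁻¹) c) ∧
    -- (d)
    (∀ (g : G) (c : C), Coalgebra.comul (R := k) (Pmap k act (δ g⁻¹) c) =
      TensorProduct.map (Pmap k act (δ g⁻¹)) (Pmap k act (δ g⁻¹)) (Coalgebra.comul (R := k) c)) ∧
    -- (e)
    (∀ (g : G) (c : C),
      Pmap k act (δ g⁻¹) c = (TensorProduct.rid k C)
        (TensorProduct.map LinearMap.id (Coalgebra.counit ∘ₗ Pmap k act (δ g⁻¹))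
          (Coalgebra.comul (R := k) c)) ∧
      Pmap k act (δ g⁻¹) c = (TensorProduct.lid k C)
        (TensorProduct.map (Coalgebra.counit ∘ₗ Pmap k act (δ g⁻¹)) LinearMap.id
          (Coalgebra.comul (R := k) c))) ∧
    -- (f)
    (∀ (g h : G) (c : C), Pmap k act (δ g⁻¹) (Pmap k act (δ h⁻¹) c) =
      Pmap k act (δ h⁻¹) (Pmap k act (δ g⁻¹) c)) ∧
    -- (g)
    (∀ c : C, Pmap k act (δ (1 : G)⁻¹) c = c) := by
  have hone (g : G) : δ g * δ g⁻¹ = 1 := by rw [← map_mul, mul_inv_cancel, map_one]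
  have hact' := hact.toIsPartialModuleCoalgebra
  have hlr (g : G) : leftHit (Coalgebra.counit ∘ₗ act (δ g⁻¹)) =
      rightHit (Coalgebra.counit ∘ₗ act (δ g⁻¹)) := by
    ext c
    rw [hact.leftHit_eq_act_act (hcomul _) (hone g),
      hact'.rightHit_eq_act_act (hcomul _) (hone g)]
  have hidem (g : G) := hact'.counit_act_leftHit (hcomul g⁻¹)
  have hcounit_leftHit (g : G) :
      Coalgebra.counit ∘ₗ leftHit (Coalgebra.counit ∘ₗ act (δ g⁻¹)) =
        Coalgebra.counit (R := k) ∘ₗ act (δ g⁻¹) :=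
    LinearMap.ext fun c => counit_leftHit _ c
  simp only [Pmap_eq_leftHit]
  refine ⟨fun g c => ?_, fun g c => hact.leftHit_eq_act_act (hcomul _) (hone g) c,
    fun g c => leftHit_leftHit_of_idem (hidem g) c,
    fun g c => comul_leftHit_of_idem (hidem g) (hlr g) c, fun g c => ?_, fun g h c => ?_,
    fun c => ?_⟩
  · rw [hlr, rightHit_apply]
  · rw [hcounit_leftHit, ← leftHit_apply, ← rightHit_apply, hlr]
    exact ⟨rfl, rfl⟩
  · rw [hlr h, leftHit_rightHit_comm]
  · have h : Coalgebra.counit ∘ₗ act (δ (1 : G)⁻¹) = Coalgebra.counit (R := k) (A := C) := by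
      ext x
      simp [hact.plhmc2]
    rw [h, leftHit_counit]
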